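/- arXiv:1511.02199 — 2 statements merged into one kernel-verified Lean document; each statement's English description precedes it below -/
import Mathlib

section
/- For every p ∈ (0,1), l ∈ ℕ, and n ∈ ℕ, the l-fold convolution of the logarithmic distribution satisfies Log(p)^{*l}(n) = l! · |s(n,l)| · p^n / (n! · (−ln(1−p))^l), where for l = 0 the left side is the point mass at 0 and both sides equal the indicator of n = 0. -/
open MeasureTheory

/-- The Poisson PMF: `Pois(λ)(n) = λ^n e^{-λ} / n!`. -/
noncomputable def poisPMF (lam : ℝ) (n : ℕ) : ℝ :=
  lam ^ n * Real.exp (-lam) / n.factorial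

/-- The gamma density with shape `a > 0` and rate `c > 0`:
`gammaPDF(a,c)(θ) = c^a / Γ(a) * θ^(a-1) * e^{-cθ}` for `θ > 0`, and `0` for `θ ≤ 0`. -/
noncomputable def gammaPDF (a c θ : ℝ) : ℝ :=
  if 0 < θ then c ^ a / Real.Gamma a * θ ^ (a - 1) * Real.exp (-(c * θ)) else 0

/-- The negative binomial PMF: `NB(r,p)(n) = Γ(n+r)/(n! Γ(r)) * p^n (1-p)^r`. -/
noncomputable def nbPMF (r p : ℝ) (n : ℕ) : ℝ :=
  Real.Gamma (n + r) / (n.factorial * Real.Gamma r) * p ^ n * (1 - p) ^ r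

/-- The unsigned Stirling number of the first kind `|s(n,l)|`: the coefficient of `X^l`
in the ascending factorial polynomial `X (X+1) ⋯ (X+n-1)`. -/
noncomputable def stirling1 (n l : ℕ) : ℕ :=
  (ascPochhammer ℕ n).coeff l

/-- The PMF of the Chinese restaurant table distribution `CRT(n,r)`: the distribution of
`l = Σ_{i=1}^n b_i` with independent `b_i ∼ Bernoulli(r/(r+i-1))`, defined by the
convolution recursion over `n`. -/
noncomputable def crtPMF (r : ℝ) : ℕ → ℕ → ℝ
  | 0, l => if l = 0 then 1 else 0
  | n + 1, l =>
      r / (r + n) * (if l = 0 then 0 else crtPMF r n (l - 1))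
        + (1 - r / (r + n)) * crtPMF r n l

/-- The logarithmic distribution PMF: `Log(p)(u) = p^u / (-ln(1-p) u)` for `u ≥ 1`, else `0`. -/
noncomputable def logPMF (p : ℝ) (u : ℕ) : ℝ :=
  if u = 0 then 0 else p ^ u / (-Real.log (1 - p) * u)

/-- The `l`-fold convolution `Log(p)^{*l}` of the logarithmic distribution, with
`Log(p)^{*0} = δ_0`. -/
noncomputable def logConv (p : ℝ) : ℕ → ℕ → ℝ
  | 0, n => if n = 0 then 1 else 0
  | l + 1, n => ∑ u ∈ Finset.range (n + 1), logPMF p u * logConv p l (n - u)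

theorem stirling1_zero (l : ℕ) : stirling1 0 l = if l = 0 then 1 else 0 := by
  simp [stirling1, Polynomial.coeff_one]

theorem stirling1_succ_zero (n : ℕ) : stirling1 (n + 1) 0 = 0 := by
  simp [stirling1, Polynomial.coeff_zero_eq_eval_zero]

theorem stirling1_succ_succ (n l : ℕ) :
    stirling1 (n + 1) (l + 1) = n * stirling1 n (l + 1) + stirling1 n l := by
  simp only [stirling1, ascPochhammer_succ_right, mul_add, Polynomial.coeff_add,
    Polynomial.coeff_mul_X, Polynomial.coeff_mul_natCast, Nat.cast_id]
  ring

/-- The formal power series `-log (1 - X) = ∑ u ≥ 1, X ^ u / u`. -/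
noncomputable def negLogOneSubSeries : PowerSeries ℝ :=
  PowerSeries.mk fun u => (u : ℝ)⁻¹

theorem one_sub_X_mul_derivative_negLogOneSubSeries :
    (1 - PowerSeries.X) * PowerSeries.derivative ℝ negLogOneSubSeries = 1 := by
  have h : PowerSeries.derivative ℝ negLogOneSubSeries = PowerSeries.mk 1 := by
    ext n
    have hn : (n : ℝ) + 1 ≠ 0 := by positivity
    simp [negLogOneSubSeries, PowerSeries.coeff_derivative, hn]
  rw [h, mul_comm, PowerSeries.mk_one_mul_one_sub_eq_one]

theorem coeff_succ_negLogOneSubSeries_pow_succ (n l : ℕ) :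
    (n + 1) * PowerSeries.coeff (n + 1) (negLogOneSubSeries ^ (l + 1))
      = n * PowerSeries.coeff n (negLogOneSubSeries ^ (l + 1))
        + (l + 1) * PowerSeries.coeff n (negLogOneSubSeries ^ l) := by
  have h : (1 - PowerSeries.X) * PowerSeries.derivative ℝ (negLogOneSubSeries ^ (l + 1))
      = PowerSeries.C (l + 1 : ℝ) * negLogOneSubSeries ^ l := by
    rw [Derivation.leibniz_pow, Nat.add_sub_cancel, smul_eq_mul, nsmul_eq_mul]
    push_cast [map_add, map_natCast, map_one]
    linear_combination
      ((l : PowerSeries ℝ) + 1) * negLogOneSubSeries ^ l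
        * one_sub_X_mul_derivative_negLogOneSubSeries
  have hc := congrArg (PowerSeries.coeff n) h
  rw [sub_mul, one_mul, map_sub, PowerSeries.coeff_C_mul, PowerSeries.coeff_derivative] at hc
  cases n with
  | zero =>
    rw [PowerSeries.coeff_zero_X_mul] at hc
    push_cast at hc ⊢
    linear_combination hc
  | succ m =>
    rw [PowerSeries.coeff_succ_X_mul, PowerSeries.coeff_derivative] at hc
    push_cast at hc ⊢
    linear_combination hc

theorem factorial_mul_coeff_negLogOneSubSeries_pow (n l : ℕ) :
    (n.factorial : ℝ) * PowerSeries.coeff n (negLogOneSubSeries ^ l)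
      = l.factorial * stirling1 n l := by
  induction n generalizing l with
  | zero =>
    rw [stirling1_zero]
    cases l <;> simp [negLogOneSubSeries]
  | succ n ih =>
    cases l with
    | zero => simp [stirling1_succ_zero, PowerSeries.coeff_one]
    | succ l =>
      have h₀ := ih l
      have h₁ := ih (l + 1)
      rw [stirling1_succ_succ]
      push_cast [Nat.factorial_succ] at h₁ ⊢
      linear_combination (n.factorial : ℝ) * coeff_succ_negLogOneSubSeries_pow_succ n l
        + (n : ℝ) * h₁ + ((l : ℝ) + 1) * h₀

theorem logConv_eq_coeff_negLogOneSubSeries_pow (p : ℝ) (l n : ℕ) :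
    logConv p l n
      = p ^ n / (-Real.log (1 - p)) ^ l * PowerSeries.coeff n (negLogOneSubSeries ^ l) := by
  induction l generalizing n with
  | zero => cases n <;> simp [logConv, PowerSeries.coeff_one]
  | succ l ih =>
    rw [logConv, pow_succ' negLogOneSubSeries, PowerSeries.coeff_mul,
      Finset.Nat.sum_antidiagonal_eq_sum_range_succ_mk, Finset.mul_sum]
    refine Finset.sum_congr rfl fun u hu => ?_
    have hp : p ^ n = p ^ u * p ^ (n - u) := by
      rw [← pow_add, Nat.add_sub_cancel' (Finset.mem_range_succ_iff.mp hu)]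
    rw [ih, hp, logPMF, negLogOneSubSeries, PowerSeries.coeff_mk]
    split_ifs with h
    · simp [h]
    · simp only [pow_succ, div_eq_mul_inv, mul_inv]
      ring

/-- For every `p ∈ (0,1)` and `l, n : ℕ`, the `l`-fold convolution of the
logarithmic distribution satisfies
`Log(p)^{*l}(n) = l! |s(n,l)| p^n / (n! (-ln(1-p))^l)`. -/
theorem logConv_eq (p : ℝ) (hp0 : 0 < p) (hp1 : p < 1) (l n : ℕ) :
    logConv p l n
      = (l.factorial : ℝ) * (stirling1 n l : ℝ) * p ^ n
          / (n.factorial * (-Real.log (1 - p)) ^ l) := by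
  rw [logConv_eq_coeff_negLogOneSubSeries_pow, ← factorial_mul_coeff_negLogOneSubSeries_pow]
  have hn : (n.factorial : ℝ) ≠ 0 := by positivity
  have hlog : -Real.log (1 - p) ≠ 0 :=
    neg_ne_zero.mpr (Real.log_neg (by linarith) (by linarith)).ne
  field_simp
end

section
/- (Equivalence of the two augmentations.) For every r > 0, p ∈ (0,1), and n, l ∈ ℕ, the joint distribution of (n,l) given by l | n ∼ CRT(n,r), n ∼ NB(r,p) equals the joint distribution given by n = Σ_{t=1}^l u_t with u_t i.i.d. Log(p) and l ∼ Pois(−r ln(1−p)); that is, NB(r,p)(n) · CRT(n,r)(l) = Pois(−r ln(1−p))(l) · Log(p)^{*l}(n) for all n, l ∈ ℕ. -/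
open MeasureTheory

theorem logConv_eq_coeff_pow (p : ℝ) (l n : ℕ) :
    logConv p l n = PowerSeries.coeff n (PowerSeries.mk (logPMF p) ^ l) := by
  induction l generalizing n with
  | zero => simp [logConv, PowerSeries.coeff_one]
  | succ l ih =>
    rw [pow_succ', PowerSeries.coeff_mul, Finset.Nat.sum_antidiagonal_eq_sum_range_succ_mk]
    simp [logConv, ih]

/-- The differential equation `(1 - p X) G' = p / (-ln(1-p))` satisfied by the generating
function `G` of the logarithmic distribution. -/
theorem one_sub_mul_derivative_mk_logPMF (p : ℝ) :
    (1 - PowerSeries.C p * PowerSeries.X) *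
        PowerSeries.derivative ℝ (PowerSeries.mk (logPMF p))
      = PowerSeries.C (p / -Real.log (1 - p)) := by
  have key (n : ℕ) : logPMF p (n + 1) * (n + 1) = p ^ (n + 1) / -Real.log (1 - p) := by
    have : (n : ℝ) + 1 ≠ 0 := by positivity
    rw [logPMF, if_neg n.succ_ne_zero, Nat.cast_succ, ← div_div, div_mul_cancel₀ _ this]
  ext n
  rw [sub_mul, one_mul, mul_assoc, map_sub, PowerSeries.coeff_C_mul, PowerSeries.coeff_C]
  cases n with
  | zero =>
    simpa [PowerSeries.coeff_derivative] using key 0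
  | succ n =>
    rw [PowerSeries.coeff_succ_X_mul, PowerSeries.coeff_derivative,
      PowerSeries.coeff_derivative, PowerSeries.coeff_mk, PowerSeries.coeff_mk, key n, key (n + 1),
      if_neg n.succ_ne_zero]
    ring

theorem logConv_succ_succ (p : ℝ) (l n : ℕ) :
    (n + 1) * logConv p (l + 1) (n + 1)
      = p * n * logConv p (l + 1) n + (l + 1) * (p / -Real.log (1 - p)) * logConv p l n := by
  have hode : (1 - PowerSeries.C p * PowerSeries.X) *
        PowerSeries.derivative ℝ (PowerSeries.mk (logPMF p) ^ (l + 1))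
      = PowerSeries.C ((l + 1) * (p / -Real.log (1 - p))) * PowerSeries.mk (logPMF p) ^ l := by
    rw [Derivation.leibniz_pow, map_mul, ← one_sub_mul_derivative_mk_logPMF]
    simp only [Nat.add_sub_cancel, smul_eq_mul, nsmul_eq_mul, map_add, map_natCast, map_one]
    push_cast
    ring
  have h := congrArg (PowerSeries.coeff n) hode
  rw [sub_mul, one_mul, mul_assoc, map_sub, PowerSeries.coeff_C_mul, PowerSeries.coeff_C_mul,
    PowerSeries.coeff_derivative, ← logConv_eq_coeff_pow, ← logConv_eq_coeff_pow] at h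
  cases n with
  | zero =>
    simp only [PowerSeries.coeff_zero_X_mul] at h
    push_cast at h ⊢
    linarith
  | succ n =>
    rw [PowerSeries.coeff_succ_X_mul, PowerSeries.coeff_derivative, ← logConv_eq_coeff_pow] at h
    push_cast at h ⊢
    linarith

theorem nbPMF_succ {r : ℝ} (hr : 0 < r) (p : ℝ) (n : ℕ) :
    nbPMF r p (n + 1) = nbPMF r p n * ((r + n) / (n + 1) * p) := by
  have hrn : (n : ℝ) + r ≠ 0 := by positivity
  have hG : Real.Gamma r ≠ 0 := (Real.Gamma_pos_of_pos hr).ne'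
  have : ((n + 1 : ℕ) : ℝ) + r = (n + r) + 1 := by push_cast; ring
  rw [nbPMF, nbPMF, this, Real.Gamma_add_one hrn, Nat.factorial_succ]
  push_cast
  field_simp
  ring

theorem poisPMF_succ (lam : ℝ) (l : ℕ) :
    poisPMF lam (l + 1) = poisPMF lam l * (lam / (l + 1)) := by
  rw [poisPMF, poisPMF, Nat.factorial_succ]
  push_cast
  field_simp
  ring

/-- (Equivalence of the two augmentations.)  For every `r > 0`, `p ∈ (0,1)`,
and `n, l : ℕ`, the joint distribution of `(n,l)` given by `l | n ∼ CRT(n,r)`, `n ∼ NB(r,p)`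
equals the joint distribution given by `n = Σ_{t=1}^l u_t`, `u_t` i.i.d. `Log(p)`,
`l ∼ Pois(-r ln(1-p))`:
`NB(r,p)(n) ⋅ CRT(n,r)(l) = Pois(-r ln(1-p))(l) ⋅ Log(p)^{*l}(n)`. -/
theorem nb_crt_eq_poisson_log (r p : ℝ) (hr : 0 < r) (hp0 : 0 < p) (hp1 : p < 1) (n l : ℕ) :
    nbPMF r p n * crtPMF r n l
      = poisPMF (-r * Real.log (1 - p)) l * logConv p l n := by
  have hL : Real.log (1 - p) ≠ 0 := (Real.log_neg (by linarith) (by linarith)).ne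
  induction n generalizing l with
  | zero =>
    cases l with
    | zero =>
      simp [nbPMF, crtPMF, poisPMF, logConv, (Real.Gamma_pos_of_pos hr).ne',
        Real.rpow_def_of_pos (sub_pos.2 hp1), mul_comm r]
    | succ l => simp [crtPMF, logConv, logPMF]
  | succ n ih =>
    have hrn : r + n ≠ 0 := by positivity
    have hn : (n : ℝ) + 1 ≠ 0 := by positivity
    have hsucc (x y : ℝ) : nbPMF r p (n + 1) * (r / (r + n) * x + (1 - r / (r + n)) * y)
        = p / (n + 1) * (r * (nbPMF r p n * x) + n * (nbPMF r p n * y)) := by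
      rw [nbPMF_succ hr]
      field_simp
      ring
    rw [crtPMF, hsucc, ih]
    cases l with
    | zero => rcases eq_or_ne n 0 with rfl | h <;> simp [logConv, *]
    | succ l =>
      have hl : (l : ℝ) + 1 ≠ 0 := by positivity
      rw [if_neg l.succ_ne_zero, Nat.add_sub_cancel, ih, poisPMF_succ,
        eq_div_of_mul_eq hn ((mul_comm _ _).trans (logConv_succ_succ p l n))]
      field_simp
      ring
end
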